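/- Let a q-digest with total count n summarize a multiset S of n values from [1,σ], and define the confidence factor θ = (1/n) · max over all leaves u of T of the sum of count along the root-to-u path in T. Then for every node v of T, the sum of count over the proper ancestors of v is at most θn; consequently, for any q ∈ (0,1), the value v.max reported by the quantile algorithm (the first node v of the post-order list L at which the running sum of counts reaches at least qn) satisfies: at least qn elements of S are ≤ v.max and at most qn + θn elements of S are strictly below all values counted past v — i.e., the rank error of any quantile query is bounded by θn. -/

import Mathlib

open scoped Classical

namespace QDigest

/-- The node set of the complete binary tree `T` over the value range `[1, σ]`,
heap-indexed by `1, …, 2σ − 1`. -/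
def nodes (σ : ℕ) : Finset ℕ := Finset.Icc 1 (2 * σ - 1)

/-- Total count `n` of a q-digest `count`. -/
def total (σ : ℕ) (count : ℕ → ℕ) : ℕ := ∑ v ∈ nodes σ, count v

/-- Parent of a non-root node `v`. -/
def parent (v : ℕ) : ℕ := v / 2

/-- Sibling of a non-root node `v` (the other child of its parent);
maps the root `1` to the non-node `0`. -/
def sibling (v : ℕ) : ℕ := if v % 2 = 0 then v + 1 else v - 1

/-- Support (node set `Q`) of a q-digest. -/
def support (σ : ℕ) (count : ℕ → ℕ) : Finset ℕ :=
  (nodes σ).filter fun v => count v ≠ 0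

/-- `u` is an ancestor of, or equal to, `v` in the heap-indexed tree. -/
def AncOrEq (u v : ℕ) : Prop := ∃ i : ℕ, v / 2 ^ i = u

/-- The leaf corresponding to the value `x ∈ [1, σ]`. -/
def leafOf (σ x : ℕ) : ℕ := σ - 1 + x

/-- Sum of the counts over the proper ancestors of `v`. -/
def ancSum (count : ℕ → ℕ) (v : ℕ) : ℕ :=
  ∑ j ∈ Finset.Icc 1 (Nat.log 2 v), count (v / 2 ^ j)

/-- Width of the dyadic interval `range(v)` of node `v`. -/
def width (σ v : ℕ) : ℕ := σ / 2 ^ Nat.log 2 v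

/-- Right endpoint `v.max` of the dyadic interval of node `v`. -/
def vmax (σ v : ℕ) : ℕ := (v + 1) * width σ v - σ

/-- Left endpoint `v.min` of the dyadic interval of node `v`. -/
def vmin (σ v : ℕ) : ℕ := v * width σ v - σ + 1

/-- The q-digest `count` summarizes the multiset `S` of values from `[1, σ]`:
there is an assignment sending each element `x` of `S` to a node of `T` that is
an ancestor of (or equal to) the leaf corresponding to `x`, such that `count v`
is the number of elements assigned to `v`. -/
def Summarizes (σ : ℕ) (count : ℕ → ℕ) (S : Multiset ℕ) : Prop :=
  ∃ P : Multiset (ℕ × ℕ),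
    P.map Prod.fst = S ∧
    (∀ p ∈ P, p.2 ∈ nodes σ ∧ AncOrEq p.2 (leafOf σ p.1)) ∧
    ∀ v : ℕ, count v = Multiset.card (P.filter fun p => p.2 = v)

/-- `true(v)`: the number of elements of `S` lying in `range(v)`. -/
noncomputable def trueCount (σ : ℕ) (S : Multiset ℕ) (v : ℕ) : ℕ :=
  Multiset.card (S.filter fun x => AncOrEq v (leafOf σ x))

/-- `sub(v)`: sum of the counts over the subtree of `T` rooted at `v`. -/
noncomputable def subSum (σ : ℕ) (count : ℕ → ℕ) (v : ℕ) : ℕ :=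
  ∑ u ∈ (nodes σ).filter (fun u => AncOrEq v u), count u

/-- `u` precedes `v`, or equals it, in the post-order of `T`: increasing right
endpoint `v.max`, ties broken by placing smaller intervals first. -/
def postLE (σ u v : ℕ) : Prop :=
  vmax σ u < vmax σ v ∨ (vmax σ u = vmax σ v ∧ width σ u ≤ width σ v)

/-- One step of COMPRESS at the sibling pair whose parent is `u`: if digest
property (2) fails for the pair, its counts are added to the parent and zeroed. -/
def compressStep (nk : ℕ) (count : ℕ → ℕ) (u : ℕ) : ℕ → ℕ :=
  if count (2 * u) + count (2 * u + 1) + count u ≤ nk then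
    fun w =>
      if w = u then count u + count (2 * u) + count (2 * u + 1)
      else if w = 2 * u ∨ w = 2 * u + 1 then 0 else count w
  else count

/-- COMPRESS(Q, n, k): process sibling pairs level by level from the leaves
upward, i.e. parents `σ - 1, σ - 2, …, 1`. -/
def compress (σ n k : ℕ) (count : ℕ → ℕ) : ℕ → ℕ :=
  (((List.range (σ - 1)).reverse).map (· + 1)).foldl
    (fun c u => compressStep (n / k) c u) count

/-- Post-order traversal of the subtree rooted at `v` (with recursion fuel). -/
def postorderAux (σ : ℕ) : ℕ → ℕ → List ℕ
  | 0, v => [v]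
  | fuel + 1, v =>
      if σ ≤ v then [v]
      else postorderAux σ fuel (2 * v) ++ postorderAux σ fuel (2 * v + 1) ++ [v]

/-- Post-order traversal of the complete binary tree over `[1, σ]`, `σ = 2 ^ h`. -/
def postorder (σ h : ℕ) : List ℕ := postorderAux σ h 1

end QDigest

namespace QDigest

/-- Halving `i` times lowers the level of a node by `i`. -/
theorem log_div_two_pow (u i : ℕ) : Nat.log 2 (u / 2 ^ i) = Nat.log 2 u - i := by
  induction i with
  | zero => simp
  | succ i ih => rw [pow_succ, ← Nat.div_div_eq_div_mul, Nat.log_div_base, ih]; omega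

theorem log_le_of_mem_nodes {h v : ℕ} (hv : v ∈ nodes (2 ^ h)) : Nat.log 2 v ≤ h := by
  rw [nodes, Finset.mem_Icc] at hv
  have : Nat.log 2 v < h + 1 := Nat.log_lt_of_lt_pow (by omega) (by rw [pow_succ]; omega)
  omega

theorem width_eq {h v : ℕ} (hv : v ∈ nodes (2 ^ h)) :
    width (2 ^ h) v = 2 ^ (h - Nat.log 2 v) :=
  Nat.pow_div (log_le_of_mem_nodes hv) two_pos

theorem vmax_add {h v : ℕ} (hv : v ∈ nodes (2 ^ h)) :
    vmax (2 ^ h) v + 2 ^ h = (v + 1) * 2 ^ (h - Nat.log 2 v) := by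
  have hv0 : v ≠ 0 := by rw [nodes, Finset.mem_Icc] at hv; omega
  have hle : 2 ^ h ≤ (v + 1) * 2 ^ (h - Nat.log 2 v) := by
    calc 2 ^ h = 2 ^ Nat.log 2 v * 2 ^ (h - Nat.log 2 v) := by
          rw [← pow_add, Nat.add_sub_cancel' (log_le_of_mem_nodes hv)]
      _ ≤ _ := Nat.mul_le_mul_right _ ((Nat.pow_log_le_self 2 hv0).trans (Nat.le_succ v))
  rw [vmax, width_eq hv]
  omega

theorem vmax_mem_Icc {h v : ℕ} (hv : v ∈ nodes (2 ^ h)) :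
    vmax (2 ^ h) v ∈ Finset.Icc 1 (2 ^ h) := by
  have hv0 : v ≠ 0 := by rw [nodes, Finset.mem_Icc] at hv; omega
  have hadd := vmax_add hv
  have hpow : 2 ^ h = 2 ^ Nat.log 2 v * 2 ^ (h - Nat.log 2 v) := by
    rw [← pow_add, Nat.add_sub_cancel' (log_le_of_mem_nodes hv)]
  have hlow := Nat.pow_log_le_self 2 hv0
  have hup : v < 2 ^ (Nat.log 2 v + 1) := Nat.lt_pow_succ_log_self one_lt_two v
  have hpos : 0 < 2 ^ (h - Nat.log 2 v) := by positivity
  rw [pow_succ] at hup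
  rw [Finset.mem_Icc]
  constructor <;> nlinarith

theorem leafOf_mem_Icc {σ x : ℕ} (hx : x ∈ Finset.Icc 1 σ) :
    leafOf σ x ∈ Finset.Icc σ (2 * σ - 1) := by
  rw [Finset.mem_Icc] at *
  unfold leafOf
  omega

theorem log_leafOf {h x : ℕ} (hx : x ∈ Finset.Icc 1 (2 ^ h)) :
    Nat.log 2 (leafOf (2 ^ h) x) = h := by
  have := leafOf_mem_Icc hx
  rw [Finset.mem_Icc] at this
  have hpos : 0 < 2 ^ h := by positivity
  exact Nat.log_eq_of_pow_le_of_lt_pow this.1 (by rw [pow_succ]; omega)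

/-- The leaves below a node `w` are those whose parent `h - log w` levels up is `w`. -/
theorem ancOrEq_leafOf_iff {h w x : ℕ} (hw : w ∈ nodes (2 ^ h))
    (hx : x ∈ Finset.Icc 1 (2 ^ h)) :
    AncOrEq w (leafOf (2 ^ h) x) ↔ leafOf (2 ^ h) x / 2 ^ (h - Nat.log 2 w) = w := by
  refine ⟨?_, fun hi => ⟨_, hi⟩⟩
  rintro ⟨i, hi⟩
  have hw0 : w ≠ 0 := by rw [nodes, Finset.mem_Icc] at hw; omega
  have hlog : Nat.log 2 w = h - i := by rw [← hi, log_div_two_pow, log_leafOf hx]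
  have hih : i ≤ h := by
    by_contra hlt
    refine hw0 (hi ▸ Nat.div_eq_of_lt ?_)
    have hlt' : leafOf (2 ^ h) x < 2 ^ (h + 1) := by
      simpa [log_leafOf hx] using Nat.lt_pow_succ_log_self one_lt_two (leafOf (2 ^ h) x)
    exact hlt'.trans_le (Nat.pow_le_pow_right two_pos (by omega))
  rwa [hlog, Nat.sub_sub_self hih]

theorem le_vmax_of_ancOrEq {h w x : ℕ} (hw : w ∈ nodes (2 ^ h))
    (hx : x ∈ Finset.Icc 1 (2 ^ h)) (hwx : AncOrEq w (leafOf (2 ^ h) x)) :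
    x ≤ vmax (2 ^ h) w := by
  rw [ancOrEq_leafOf_iff hw hx, Nat.div_eq_iff (by positivity)] at hwx
  have hadd := vmax_add hw
  have hpos : 0 < 2 ^ (h - Nat.log 2 w) := by positivity
  have hpos' : 0 < 2 ^ h := by positivity
  rw [add_mul, one_mul] at hadd
  unfold leafOf at hwx
  omega

/-- The interval of a node is convex towards its right endpoint. -/
theorem ancOrEq_leafOf_of_le {h w x y : ℕ} (hw : w ∈ nodes (2 ^ h))
    (hx : x ∈ Finset.Icc 1 (2 ^ h)) (hwx : AncOrEq w (leafOf (2 ^ h) x))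
    (hxy : x ≤ y) (hy : y ≤ vmax (2 ^ h) w) : AncOrEq w (leafOf (2 ^ h) y) := by
  rw [ancOrEq_leafOf_iff hw hx, Nat.div_eq_iff (by positivity)] at hwx
  refine ⟨h - Nat.log 2 w, ?_⟩
  rw [Nat.div_eq_iff (by positivity)]
  have hadd := vmax_add hw
  have hpos : 0 < 2 ^ (h - Nat.log 2 w) := by positivity
  have hpos' : 0 < 2 ^ h := by positivity
  rw [add_mul, one_mul] at hadd
  unfold leafOf at *
  omega

theorem leafOf_vmax_div {h v : ℕ} (hv : v ∈ nodes (2 ^ h)) :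
    leafOf (2 ^ h) (vmax (2 ^ h) v) / 2 ^ (h - Nat.log 2 v) = v := by
  rw [Nat.div_eq_iff (by positivity)]
  have hadd := vmax_add hv
  have hpos : 0 < 2 ^ (h - Nat.log 2 v) := by positivity
  have hpos' : 0 < 2 ^ h := by positivity
  rw [add_mul, one_mul] at hadd
  unfold leafOf
  omega

theorem injOn_div_two_pow (u : ℕ) :
    Set.InjOn (fun j => u / 2 ^ j) (Finset.Icc 0 (Nat.log 2 u)) := by
  intro i hi j hj hij
  have := congrArg (Nat.log 2) hij
  simp only [log_div_two_pow] at this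
  simp only [Finset.coe_Icc, Set.mem_Icc] at hi hj
  omega

/-- Any set of nodes on the root-to-`u` path has count at most that of the whole path. -/
theorem sum_ancestors_le (count : ℕ → ℕ) (u : ℕ) (A : Finset ℕ)
    (hA : ∀ w ∈ A, w ≠ 0 ∧ AncOrEq w u) : ∑ w ∈ A, count w ≤ count u + ancSum count u := by
  have hpath : ∑ w ∈ (Finset.Icc 0 (Nat.log 2 u)).image (fun j => u / 2 ^ j), count w
      = count u + ancSum count u := by
    rw [Finset.sum_image (injOn_div_two_pow u), ← Finset.add_sum_Ioc_eq_sum_Icc (Nat.zero_le _)]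
    simp [ancSum, ← Finset.Icc_add_one_left_eq_Ioc]
  rw [← hpath]
  refine Finset.sum_le_sum_of_subset fun w hw => ?_
  obtain ⟨hw0, i, rfl⟩ := hA w hw
  refine Finset.mem_image.2 ⟨i, Finset.mem_Icc.2 ⟨Nat.zero_le _, ?_⟩, rfl⟩
  exact Nat.le_log_of_pow_le one_lt_two (by
    by_contra hlt
    exact hw0 (Nat.div_eq_of_lt (not_le.1 hlt)))

theorem ancSum_le_leafOf_vmax {h v : ℕ} (count : ℕ → ℕ) (hv : v ∈ nodes (2 ^ h)) :
    ancSum count v ≤ count (leafOf (2 ^ h) (vmax (2 ^ h) v))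
      + ancSum count (leafOf (2 ^ h) (vmax (2 ^ h) v)) := by
  have hv0 : v ≠ 0 := by rw [nodes, Finset.mem_Icc] at hv; omega
  have hinj : Set.InjOn (fun j => v / 2 ^ j) (Finset.Icc 1 (Nat.log 2 v)) :=
    (injOn_div_two_pow v).mono (Finset.coe_subset.2 (Finset.Icc_subset_Icc_left zero_le_one))
  rw [ancSum, ← Finset.sum_image (f := count) hinj]
  refine sum_ancestors_le count _ _ fun w hw => ?_
  obtain ⟨j, hj, rfl⟩ := Finset.mem_image.1 hw
  constructor
  · have hle : 2 ^ j ≤ v := Nat.pow_le_of_le_log hv0 (Finset.mem_Icc.1 hj).2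
    exact (Nat.div_pos hle (by positivity)).ne'
  · refine ⟨h - Nat.log 2 v + j, ?_⟩
    rw [pow_add, ← Nat.div_div_eq_div_mul, leafOf_vmax_div hv]

theorem card_filter_le_card_filter {α : Type*} {s : Multiset α} {p q : α → Prop}
    [DecidablePred p] [DecidablePred q] (hpq : ∀ a ∈ s, p a → q a) :
    Multiset.card (s.filter p) ≤ Multiset.card (s.filter q) :=
  Multiset.card_le_card <| Multiset.le_filter.2 ⟨Multiset.filter_le _ _, fun a ha =>
    hpq a (Multiset.mem_of_mem_filter ha) (Multiset.of_mem_filter ha)⟩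

theorem sum_card_filter_eq {α β : Type*} [DecidableEq β] (f : α → β) (s : Multiset α)
    (A : Finset β) :
    ∑ w ∈ A, Multiset.card (s.filter fun a => f a = w)
      = Multiset.card (s.filter fun a => f a ∈ A) := by
  induction s using Multiset.induction_on with
  | empty => simp
  | cons a s ih =>
    simp only [← Multiset.countP_eq_card_filter] at *
    simp only [Multiset.countP_cons, Finset.sum_add_distrib, ih, Finset.sum_ite_eq]

end QDigest

open QDigest

/-- let a q-digest with total count `n` summarize a multiset `S`
of `n` values from `[1, σ]`, and define the confidence factor
`θ = (1/n) · max over leaves u of the sum of the counts on the root-to-u path`.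
Then the sum of the counts over the proper ancestors of any node is at most
`θ·n`; consequently, for any `q ∈ (0,1)`, the node `v` reported by the quantile
algorithm (the first node of the post-order list at which the running sum of
the counts reaches at least `q·n`) satisfies: at least `q·n` elements of `S`
are `≤ v.max`, and at most `q·n + θ·n` elements of `S` are `< v.max` — the
rank error of any quantile query is bounded by `θ·n`. -/
theorem confidence_factor_bound
    (h σ : ℕ) (hh : 1 ≤ h) (hσ : σ = 2 ^ h)
    (count : ℕ → ℕ) (hsupp : ∀ v, count v ≠ 0 → v ∈ nodes σ)
    (S : Multiset ℕ) (hS : ∀ x ∈ S, x ∈ Finset.Icc 1 σ)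
    (n : ℕ) (hn1 : 1 ≤ n) (hcard : Multiset.card S = n) (hn : total σ count = n)
    (hsum : Summarizes σ count S)
    (θ : ℝ)
    (hθ : θ = (((Finset.Icc σ (2 * σ - 1)).sup
        (fun u => count u + ancSum count u) : ℕ) : ℝ) / (n : ℝ)) :
    (∀ v ∈ nodes σ, (ancSum count v : ℝ) ≤ θ * (n : ℝ)) ∧
    (∀ q : ℝ, 0 < q → q < 1 → ∀ v ∈ support σ count,
      q * (n : ℝ)
          ≤ ((∑ w ∈ (support σ count).filter (fun w => postLE σ w v), count w : ℕ) : ℝ) →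
      ((∑ w ∈ (support σ count).filter (fun w => postLE σ w v ∧ w ≠ v),
          count w : ℕ) : ℝ) < q * (n : ℝ) →
      q * (n : ℝ) ≤ (Multiset.card (S.filter fun x => x ≤ vmax σ v) : ℝ) ∧
      (Multiset.card (S.filter fun x => x < vmax σ v) : ℝ)
        ≤ q * (n : ℝ) + θ * (n : ℝ)) := by
  subst hσ
  obtain ⟨P, hPS, hPanc, hPcount⟩ := hsum
  have hθn : θ * n = ((Finset.Icc (2 ^ h) (2 * 2 ^ h - 1)).sup
      (fun u => count u + ancSum count u) : ℕ) := by
    rw [hθ, div_mul_cancel₀]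
    exact_mod_cast (by omega : n ≠ 0)
  have hpath : ∀ v ∈ nodes (2 ^ h), count (leafOf (2 ^ h) (vmax (2 ^ h) v))
      + ancSum count (leafOf (2 ^ h) (vmax (2 ^ h) v))
      ≤ (Finset.Icc (2 ^ h) (2 * 2 ^ h - 1)).sup (fun u => count u + ancSum count u) :=
    fun v hv => Finset.le_sup (f := fun u => count u + ancSum count u)
      (leafOf_mem_Icc (vmax_mem_Icc hv))
  have hPsupp : ∀ p ∈ P, p.2 ∈ support (2 ^ h) count := fun p hp => by
    refine Finset.mem_filter.2 ⟨(hPanc p hp).1, ?_⟩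
    rw [hPcount, ← Nat.pos_iff_ne_zero, Multiset.card_pos_iff_exists_mem]
    exact ⟨p, Multiset.mem_filter.2 ⟨hp, rfl⟩⟩
  have hPval : ∀ p ∈ P, p.1 ∈ Finset.Icc 1 (2 ^ h) := fun p hp =>
    hS _ (hPS ▸ Multiset.mem_map_of_mem _ hp)
  have hcountP : ∀ A : Finset ℕ,
      ∑ w ∈ A, count w = Multiset.card (P.filter fun p => p.2 ∈ A) := fun A => by
    rw [← sum_card_filter_eq]
    exact Finset.sum_congr rfl fun w _ => hPcount w
  refine ⟨fun v hv => ?_, fun q _ _ v hv hreach hbefore => ⟨hreach.trans ?_, ?_⟩⟩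
  · rw [hθn]
    exact_mod_cast (ancSum_le_leafOf_vmax count hv).trans (hpath v hv)
  · rw [hcountP, ← hPS, Multiset.filter_map, Multiset.card_map]
    refine Nat.cast_le.2 (card_filter_le_card_filter fun p hp hpv => ?_)
    have hle : vmax (2 ^ h) p.2 ≤ vmax (2 ^ h) v :=
      (Finset.mem_filter.1 hpv).2.elim le_of_lt fun heq => heq.1.le
    exact (le_vmax_of_ancOrEq (hPanc p hp).1 (hPval p hp) (hPanc p hp).2).trans hle
  · have hvn : v ∈ nodes (2 ^ h) := (Finset.mem_filter.1 hv).1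
    set B := (support (2 ^ h) count).filter fun w => postLE (2 ^ h) w v ∧ w ≠ v
    set A := (support (2 ^ h) count).filter fun w =>
      AncOrEq w (leafOf (2 ^ h) (vmax (2 ^ h) v))
    have hsplit : Multiset.card (S.filter fun x => x < vmax (2 ^ h) v)
        ≤ ∑ w ∈ B ∪ A, count w := by
      rw [hcountP, ← hPS, Multiset.filter_map, Multiset.card_map]
      refine card_filter_le_card_filter fun p hp hpv => ?_
      have hps := hPsupp p hp
      obtain ⟨hpn, hpanc⟩ := hPanc p hp
      rw [Finset.mem_union, or_iff_not_imp_left]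
      intro hnB
      refine Finset.mem_filter.2 ⟨hps, ancOrEq_leafOf_of_le hpn (hPval p hp) hpanc
        (le_of_lt hpv) ?_⟩
      by_contra hlt
      refine hnB (Finset.mem_filter.2 ⟨hps, Or.inl (not_le.1 hlt), ?_⟩)
      intro heq
      exact hlt (heq ▸ le_rfl)
    have hAle : ∑ w ∈ A, count w ≤ (Finset.Icc (2 ^ h) (2 * 2 ^ h - 1)).sup
        (fun u => count u + ancSum count u) := by
      refine (sum_ancestors_le count _ A fun w hw => ?_).trans (hpath v hvn)
      obtain ⟨hws, hwanc⟩ := Finset.mem_filter.1 hw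
      have hwn := (Finset.mem_filter.1 hws).1
      rw [nodes, Finset.mem_Icc] at hwn
      exact ⟨by omega, hwanc⟩
    have hunion := Finset.sum_union_inter (s₁ := B) (s₂ := A) (f := count)
    have hbound : (Multiset.card (S.filter fun x => x < vmax (2 ^ h) v) : ℝ)
        ≤ (∑ w ∈ B, count w : ℕ) + ((Finset.Icc (2 ^ h) (2 * 2 ^ h - 1)).sup
          (fun u => count u + ancSum count u) : ℕ) := by
      exact_mod_cast (by omega)
    rw [hθn]
    linarith
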